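/- Commutator estimate: Let 1 ≤ r ≤ ∞, 1 ≤ p ≤ p₁ ≤ ∞ and 1/p₂ = 1/p − 1/p₁. There exists a constant C depending continuously on p, p₁ such that for all suitable v, f, ‖(2ʲ‖[Δⱼ, v∂_x]f‖_{L^p})_{j≥−1}‖_{ℓ^r} ≤ C(‖∂_x v‖_{L^∞}‖f‖_{B¹_{p,r}} + ‖∂_x f‖_{L^{p₂}}‖∂_x v‖_{B⁰_{p₁,r}}). -/

import Mathlib

open MeasureTheory FourierTransform ENNReal

/-- The inhomogeneous Littlewood–Paley blocks built from a low-frequency symbol `χ`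
(index `0`, i.e. `j = -1`) and a dyadic annulus symbol `φsym` (index `j+1` corresponds to
the dyadic block `Δⱼ`, `j ≥ 0`). -/
noncomputable def LPblock (χ φsym : ℝ → ℂ) (j : ℕ) (g : ℝ → ℂ) : ℝ → ℂ :=
  if j = 0 then 𝓕⁻ (fun ξ => χ ξ * 𝓕 g ξ)
  else 𝓕⁻ (fun ξ => φsym ((2 : ℝ) ^ (-((j : ℝ) - 1)) * ξ) * 𝓕 g ξ)

/-- The nonhomogeneous Besov norm `‖g‖_{B^s_{p,r}}`; the index `j ∈ ℕ` corresponds to the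
usual Littlewood–Paley index `j - 1 ∈ {-1, 0, 1, …}`. -/
noncomputable def besovNorm (χ φsym : ℝ → ℂ) (s : ℝ) (p r : ℝ≥0∞) (g : ℝ → ℂ) : ℝ :=
  (eLpNorm
      (fun j : ℕ => (2 : ℝ) ^ (((j : ℝ) - 1) * s) *
        (eLpNorm (LPblock χ φsym j g) p volume).toReal)
      r Measure.count).toReal

open MeasureTheory FourierTransform ENNReal

theorem schur_test {X Y : Type*} [MeasurableSpace X] [MeasurableSpace Y] (μ : Measure X)
    (ν : Measure Y) [SFinite μ] [SFinite ν] (K : X → Y → ℝ≥0∞)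
    (hK : Measurable (Function.uncurry K)) (A : ℝ≥0∞)
    (hA1 : ∀ x, ∫⁻ y, K x y ∂ν ≤ A) (hA2 : ∀ y, ∫⁻ x, K x y ∂μ ≤ A)
    (p : ℝ≥0∞) (hp : 1 ≤ p) (g : Y → ℝ≥0∞) (hg : Measurable g) :
    eLpNorm (fun x => ∫⁻ y, K x y * g y ∂ν) p μ ≤ A * eLpNorm g p ν := by
  have hKx : ∀ x, Measurable (K x) := fun x => hK.comp measurable_prodMk_left
  have hKy : ∀ y, Measurable (fun x => K x y) := fun y => hK.comp measurable_prodMk_right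
  by_cases htop : p = ∞
  · subst htop
    rw [eLpNorm_exponent_top, eLpNorm_exponent_top]
    refine essSup_le_of_ae_le _ (Filter.Eventually.of_forall fun x => ?_)
    simp only [enorm_eq_self]
    calc ∫⁻ y, K x y * g y ∂ν ≤ ∫⁻ y, K x y * eLpNormEssSup g ν ∂ν := by
          refine lintegral_mono_ae ?_
          filter_upwards [enorm_ae_le_eLpNormEssSup g ν] with y hy
          gcongr
          simpa using hy
      _ = (∫⁻ y, K x y ∂ν) * eLpNormEssSup g ν := lintegral_mul_const _ (hKx x)
      _ ≤ _ := by gcongr; exact hA1 x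
  have hp0 : p ≠ 0 := (lt_of_lt_of_le one_pos hp).ne'
  have hp1 : 1 ≤ p.toReal := by
    have := ENNReal.toReal_mono htop hp
    simpa using this
  have key : ∀ x, (∫⁻ y, K x y * g y ∂ν) ^ p.toReal
      ≤ A ^ (p.toReal - 1) * ∫⁻ y, K x y * g y ^ p.toReal ∂ν := by
    intro x
    rcases eq_or_lt_of_le hp1 with h | h
    · simp [← h]
    have hc : p.toReal.HolderConjugate (p.toReal.conjExponent) := .conjExponent h
    set s := p.toReal with hs
    set q := s.conjExponent
    have hs0 : 0 < s := by linarith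
    have h1 := ENNReal.lintegral_mul_le_Lp_mul_Lq ν hc (f := fun y => K x y ^ (1/s) * g y)
      (g := fun y => K x y ^ (1/q)) (by fun_prop) (by fun_prop)
    have e1 : ∀ y, (((fun y => K x y ^ (1/s) * g y) * fun y => K x y ^ (1/q)) : Y → ℝ≥0∞) y
        = K x y * g y := by
      intro y
      simp only [Pi.mul_apply]
      rw [mul_right_comm, ← ENNReal.rpow_add_of_nonneg _ _ (by positivity)
        (one_div_nonneg.2 hc.symm.nonneg)]
      have : 1/s + 1/q = 1 := by simpa using hc.inv_add_inv_eq_one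
      rw [this, ENNReal.rpow_one]
    have e2 : ∀ y, ((fun y => K x y ^ (1/s) * g y) y) ^ s = K x y * g y ^ s := by
      intro y
      simp only
      rw [ENNReal.mul_rpow_of_nonneg _ _ hs0.le, ← ENNReal.rpow_mul, one_div_mul_cancel hs0.ne',
        ENNReal.rpow_one]
    have e3 : ∀ y, ((fun y => K x y ^ (1/q)) y) ^ q = K x y := by
      intro y
      simp only
      rw [← ENNReal.rpow_mul, one_div_mul_cancel hc.symm.ne_zero, ENNReal.rpow_one]
    simp only [e1, e2, e3] at h1
    calc (∫⁻ y, K x y * g y ∂ν) ^ s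
        ≤ ((∫⁻ y, K x y * g y ^ s ∂ν) ^ (1/s) * (∫⁻ y, K x y ∂ν) ^ (1/q)) ^ s := by gcongr
      _ ≤ ((∫⁻ y, K x y * g y ^ s ∂ν) ^ (1/s) * A ^ (1/q)) ^ s := by
          gcongr
          · exact one_div_nonneg.2 hc.symm.nonneg
          · exact hA1 x
      _ = A ^ (s - 1) * ∫⁻ y, K x y * g y ^ s ∂ν := by
          rw [ENNReal.mul_rpow_of_nonneg _ _ hs0.le, ← ENNReal.rpow_mul, ← ENNReal.rpow_mul,
            one_div_mul_cancel hs0.ne', ENNReal.rpow_one, mul_comm]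
          congr 2
          have h2 : 1 / s + 1 / q = 1 := by simpa using hc.inv_add_inv_eq_one
          have h3 : 1 / q = 1 - 1 / s := by linarith
          rw [h3, sub_mul, one_div_mul_cancel hs0.ne', one_mul]
  rw [eLpNorm_eq_lintegral_rpow_enorm_toReal hp0 htop, eLpNorm_eq_lintegral_rpow_enorm_toReal hp0 htop]
  simp only [enorm_eq_self]
  have hs0 : 0 < p.toReal := by linarith
  calc (∫⁻ x, (∫⁻ y, K x y * g y ∂ν) ^ p.toReal ∂μ) ^ (1 / p.toReal)
      ≤ (A ^ p.toReal * ∫⁻ y, g y ^ p.toReal ∂ν) ^ (1 / p.toReal) := by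
        gcongr
        calc (∫⁻ x, (∫⁻ y, K x y * g y ∂ν) ^ p.toReal ∂μ)
            ≤ ∫⁻ x, A ^ (p.toReal - 1) * ∫⁻ y, K x y * g y ^ p.toReal ∂ν ∂μ := lintegral_mono key
          _ = A ^ (p.toReal - 1) * ∫⁻ x, ∫⁻ y, K x y * g y ^ p.toReal ∂ν ∂μ := by
              rw [lintegral_const_mul]
              apply Measurable.lintegral_prod_right
              exact hK.mul ((hg.pow_const _).comp measurable_snd)
          _ = A ^ (p.toReal - 1) * ∫⁻ y, ∫⁻ x, K x y * g y ^ p.toReal ∂μ ∂ν := by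
              rw [lintegral_lintegral_swap]
              exact (hK.mul ((hg.pow_const _).comp measurable_snd)).aemeasurable
          _ ≤ A ^ (p.toReal - 1) * ∫⁻ y, A * g y ^ p.toReal ∂ν := by
              gcongr with y
              rw [lintegral_mul_const _ (hKy y)]
              gcongr
              exact hA2 y
          _ = A ^ p.toReal * ∫⁻ y, g y ^ p.toReal ∂ν := by
              rw [lintegral_const_mul _ (hg.pow_const _), ← mul_assoc]
              congr 1
              conv_lhs => rw [← ENNReal.rpow_one A, ← ENNReal.rpow_mul, one_mul]
              rw [← ENNReal.rpow_add_of_nonneg _ _ (by linarith) zero_le_one]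
              ring_nf
    _ = _ := by
        rw [ENNReal.mul_rpow_of_nonneg _ _ (by positivity), ← ENNReal.rpow_mul,
          mul_one_div_cancel hs0.ne', ENNReal.rpow_one]

/-- Young-type bound on ℝ. -/
theorem young_bound (k : ℝ → ℝ≥0∞) (hk : Measurable k) (p : ℝ≥0∞) (hp : 1 ≤ p)
    (F g : ℝ → ℂ) (hg : Measurable g)
    (h : ∀ x, ‖F x‖ₑ ≤ ∫⁻ t, k t * ‖g (x - t)‖ₑ) :
    eLpNorm F p volume ≤ (∫⁻ t, k t) * eLpNorm g p volume := by
  have h1 := schur_test (volume : Measure ℝ) (volume : Measure ℝ) (fun x y => k (x - y))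
    (hk.comp (measurable_fst.sub measurable_snd)) (∫⁻ t, k t)
    (fun x => (lintegral_sub_left_eq_self k x).le)
    (fun y => (lintegral_sub_right_eq_self k y).le) p hp (fun y => ‖g y‖ₑ) hg.enorm
  calc eLpNorm F p volume ≤ eLpNorm (fun x => ∫⁻ y, k (x - y) * ‖g y‖ₑ) p volume := by
        refine eLpNorm_mono_enorm fun x => (h x).trans ?_
        rw [enorm_eq_self]
        rw [← lintegral_sub_left_eq_self (fun y => k (x - y) * ‖g y‖ₑ) x]
        simp
    _ ≤ _ := h1
    _ = _ := by rw [eLpNorm_enorm]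
/-- product of Schwartz functions -/
noncomputable def SP (a b : SchwartzMap ℝ ℂ) : SchwartzMap ℝ ℂ :=
  SchwartzMap.pairing (ContinuousLinearMap.mul ℂ ℂ) a b

theorem SP_apply (a b : SchwartzMap ℝ ℂ) (x : ℝ) : SP a b x = a x * b x := by
  simp [SP, SchwartzMap.pairing_apply_apply]

/-- Fourier multiplier -/
noncomputable def SM (σ g : SchwartzMap ℝ ℂ) : SchwartzMap ℝ ℂ := 𝓕⁻ (SP σ (𝓕 g))

theorem four_SM (σ g : SchwartzMap ℝ ℂ) : 𝓕 (SM σ g) = SP σ (𝓕 g) := by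
  simp [SM]

theorem SM_apply (σ g : SchwartzMap ℝ ℂ) (x : ℝ) :
    SM σ g x = ∫ t, (𝓕⁻ σ) t * g (x - t) := by
  have h : SM σ g = SchwartzMap.convolution (ContinuousLinearMap.mul ℂ ℂ) (𝓕⁻ σ) g := by
    apply (FourierTransform.fourierEquiv ℂ (SchwartzMap ℝ ℂ)).injective
    simp only [FourierTransform.fourierEquiv_apply]
    rw [four_SM, SchwartzMap.fourier_convolution]
    simp [SP]
  rw [h, SchwartzMap.convolution_apply]
  simp [convolution]

theorem SM_ext {a b : SchwartzMap ℝ ℂ} (h : ∀ ξ, (𝓕 a) ξ = (𝓕 b) ξ) : a = b := by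
  apply (FourierTransform.fourierEquiv ℂ (SchwartzMap ℝ ℂ)).injective
  ext ξ
  simpa using h ξ

theorem SM_apply_four (σ g : SchwartzMap ℝ ℂ) (ξ : ℝ) :
    (𝓕 (SM σ g)) ξ = σ ξ * (𝓕 g) ξ := by
  rw [four_SM, SP_apply]

/-- derivative -/
noncomputable def SD (g : SchwartzMap ℝ ℂ) : SchwartzMap ℝ ℂ := SchwartzMap.derivCLM ℂ ℂ g

theorem SD_coe (g : SchwartzMap ℝ ℂ) : ⇑(SD g) = deriv g := by
  ext x; simp [SD]

theorem four_SD (g : SchwartzMap ℝ ℂ) (ξ : ℝ) :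
    (𝓕 (SD g)) ξ = 2 * Real.pi * Complex.I * ξ * (𝓕 g) ξ := by
  rw [SchwartzMap.fourier_coe, SD_coe, Real.fourier_deriv g.integrable g.differentiable]
  · simp [SchwartzMap.fourier_coe]
  · rw [← SD_coe]; exact (SD g).integrable

theorem SM_SD (σ g : SchwartzMap ℝ ℂ) : SM σ (SD g) = SD (SM σ g) := by
  apply SM_ext
  intro ξ
  rw [SM_apply_four, four_SD, four_SD, SM_apply_four]; ring

theorem four_add (a b : SchwartzMap ℝ ℂ) (ξ : ℝ) : (𝓕 (a + b)) ξ = (𝓕 a) ξ + (𝓕 b) ξ := by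
  simp [FourierTransform.fourier_add]
theorem four_sub (a b : SchwartzMap ℝ ℂ) (ξ : ℝ) : (𝓕 (a - b)) ξ = (𝓕 a) ξ - (𝓕 b) ξ := by
  simp [sub_eq_add_neg, FourierTransform.fourier_add, FourierTransform.fourier_neg]

theorem four_sum {ι : Type*} (s : Finset ι) (a : ι → SchwartzMap ℝ ℂ) (ξ : ℝ) :
    (𝓕 (∑ i ∈ s, a i)) ξ = ∑ i ∈ s, (𝓕 (a i)) ξ := by
  simp [FourierTransform.fourier_sum]

theorem four_SP_zero (w g : SchwartzMap ℝ ℂ) (ξ : ℝ)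
    (h : ∀ η, (𝓕 w) η ≠ 0 → (𝓕 g) (ξ - η) = 0) : (𝓕 (SP w g)) ξ = 0 := by
  have h2 : SchwartzMap.convolution (ContinuousLinearMap.mul ℂ ℂ) (𝓕 w) (𝓕 g) = 𝓕 (SP w g) := by
    have hF : ∀ (u : SchwartzMap ℝ ℂ) (x : ℝ), (𝓕 (𝓕 u)) (-x) = u x := by
      intro u x
      have h1 : (𝓕⁻ (𝓕 u)) x = u x := by simp
      rw [← h1, SchwartzMap.fourierInv_coe, SchwartzMap.fourier_coe,
        Real.fourierInv_eq_fourier_neg]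
    have h3 : SchwartzMap.convolution (ContinuousLinearMap.mul ℂ ℂ) (𝓕 w) (𝓕 g)
        = 𝓕⁻ (SP (𝓕 (𝓕 w)) (𝓕 (𝓕 g))) := rfl
    ext ξ
    rw [h3, SchwartzMap.fourierInv_coe, SchwartzMap.fourier_coe,
      Real.fourierInv_eq_fourier_comp_neg]
    have h4 : (fun x : ℝ => (SP (𝓕 (𝓕 w)) (𝓕 (𝓕 g))) (-x)) = ⇑(SP w g) := by
      ext x
      rw [SP_apply, SP_apply, hF, hF]
    rw [h4]
  rw [← h2, SchwartzMap.convolution_apply]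
  simp only [convolution]
  rw [← integral_zero ℝ ℂ]
  congr 1
  ext η
  by_cases hη : (𝓕 w) η = 0
  · simp [hη]
  · simp [h η hη]

/-- dilation of symbols: `dil n σ ξ = σ (2^{-n} ξ)` -/
noncomputable def dil (n : ℕ) (σ : SchwartzMap ℝ ℂ) : SchwartzMap ℝ ℂ :=
  SchwartzMap.compCLMOfContinuousLinearEquiv ℂ
    (ContinuousLinearEquiv.smulLeft (Units.mk0 ((2 : ℝ) ^ (-(n : ℝ))) (by positivity)) : ℝ ≃L[ℝ] ℝ) σ

theorem dil_apply (n : ℕ) (σ : SchwartzMap ℝ ℂ) (ξ : ℝ) :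
    dil n σ ξ = σ ((2 : ℝ) ^ (-(n : ℝ)) * ξ) := by
  simp [dil]

theorem ker_dil (n : ℕ) (σ : SchwartzMap ℝ ℂ) (t : ℝ) :
    (𝓕⁻ (dil n σ)) t = (2 : ℂ) ^ n * (𝓕⁻ σ) ((2 : ℝ) ^ n * t) := by
  rw [SchwartzMap.fourierInv_coe, SchwartzMap.fourierInv_coe, Real.fourierInv_eq',
    Real.fourierInv_eq']
  have := Measure.integral_comp_mul_left (fun y : ℝ => Complex.exp ((2 * Real.pi * inner ℝ y ((2 : ℝ)^n * t) : ℝ) * Complex.I) • σ y) ((2 : ℝ) ^ (-(n : ℝ)))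
  have h2 : |((2 : ℝ) ^ (-(n : ℝ)))⁻¹| = 2 ^ n := by
    rw [abs_of_pos (by positivity), Real.rpow_neg (by norm_num), inv_inv, Real.rpow_natCast]
  rw [h2] at this
  simp only [Complex.real_smul] at this
  push_cast at this
  push_cast
  rw [← this]
  congr 1
  ext y
  rw [dil_apply]
  congr 3
  simp only [RCLike.inner_apply, conj_trivial, Complex.ofReal_mul]
  have h3 : ((2 : ℂ) ^ n * (((2 : ℝ) ^ (-(n : ℝ)) : ℝ) : ℂ)) = 1 := by
    have : ((2 : ℝ) ^ n * ((2 : ℝ) ^ (-(n : ℝ)) : ℝ)) = 1 := by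
      rw [Real.rpow_neg (by norm_num), Real.rpow_natCast, mul_inv_cancel₀ (by positivity)]
    exact_mod_cast this
  rw [Complex.ofReal_pow, Complex.ofReal_ofNat]
  linear_combination (-(2 * Real.pi * t * y) : ℂ) * h3

theorem lint_scale (n : ℕ) (f : ℝ → ℝ≥0∞) (hf : Measurable f) :
    2 ^ n * ∫⁻ t, f ((2 : ℝ) ^ n * t) = ∫⁻ t, f t := by
  have h := Real.smul_map_volume_mul_left (a := (2 : ℝ) ^ n) (by positivity)
  conv_rhs => rw [← h]
  rw [lintegral_smul_measure, lintegral_map hf (by fun_prop), abs_of_pos (by positivity),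
    ENNReal.ofReal_pow (by norm_num)]
  simp

theorem enorm_two_pow (n : ℕ) : ‖(2 : ℂ) ^ n‖ₑ = 2 ^ n := by
  rw [enorm_pow]
  congr 1
  rw [← ofReal_norm]; simp

theorem lint_ker_dil (n : ℕ) (σ : SchwartzMap ℝ ℂ) :
    ∫⁻ t, ‖(𝓕⁻ (dil n σ)) t‖ₑ = ∫⁻ t, ‖(𝓕⁻ σ) t‖ₑ := by
  have hm : Measurable fun t => ‖(𝓕⁻ σ) t‖ₑ := (𝓕⁻ σ).continuous.measurable.enorm
  have hm1 : Measurable fun t => ‖(𝓕⁻ σ) ((2 : ℝ) ^ n * t)‖ₑ :=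
    hm.comp (measurable_const_mul ((2 : ℝ) ^ n))
  rw [← lint_scale n _ hm, ← lintegral_const_mul _ hm1]
  congr 1
  ext t
  rw [ker_dil, enorm_mul, enorm_two_pow]

theorem lint_ker_dil' (n : ℕ) (σ : SchwartzMap ℝ ℂ) :
    ∫⁻ t, ‖t‖ₑ * ‖(𝓕⁻ (dil n σ)) t‖ₑ = (2 ^ n)⁻¹ * ∫⁻ t, ‖t‖ₑ * ‖(𝓕⁻ σ) t‖ₑ := by
  have hm0 : Measurable fun t => ‖(𝓕⁻ σ) t‖ₑ := (𝓕⁻ σ).continuous.measurable.enorm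
  have hm : Measurable fun t => ‖t‖ₑ * ‖(𝓕⁻ σ) t‖ₑ := by fun_prop
  have hm1 : Measurable fun t => ‖(2 : ℝ) ^ n * t‖ₑ * ‖(𝓕⁻ σ) ((2 : ℝ) ^ n * t)‖ₑ :=
    hm.comp (measurable_const_mul ((2 : ℝ) ^ n))
  rw [← lint_scale n _ hm, ← lintegral_const_mul _ hm1, ← lintegral_const_mul _ (hm1.const_mul _)]
  congr 1
  ext t
  rw [ker_dil, enorm_mul, enorm_two_pow, enorm_mul]
  have h2 : ‖(2 : ℝ) ^ n‖ₑ = 2 ^ n := by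
    rw [enorm_pow]
    congr 1
    rw [← ofReal_norm]; simp
  rw [h2]
  have h3 : ((2 : ℝ≥0∞) ^ n)⁻¹ * 2 ^ n = 1 := ENNReal.inv_mul_cancel (by simp) (by finiteness)
  calc _ = 1 * (‖t‖ₑ * (2 ^ n * ‖(𝓕⁻ σ) ((2 : ℝ) ^ n * t)‖ₑ)) := by ring
    _ = _ := by rw [← h3]; ring

theorem SM_bound (σ : SchwartzMap ℝ ℂ) : ∃ C : ℝ≥0∞, C ≠ ∞ ∧ ∀ (n : ℕ) (p : ℝ≥0∞), 1 ≤ p →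
    ∀ g : SchwartzMap ℝ ℂ, eLpNorm (SM (dil n σ) g) p volume ≤ C * eLpNorm g p volume := by
  refine ⟨∫⁻ t, ‖(𝓕⁻ σ) t‖ₑ, (𝓕⁻ σ).integrable.2.ne, fun n p hp g => ?_⟩
  rw [← lint_ker_dil n σ]
  refine young_bound _ (𝓕⁻ (dil n σ)).continuous.measurable.enorm p hp _ _
    g.continuous.measurable fun x => ?_
  rw [SM_apply]
  refine (enorm_integral_le_lintegral_enorm _).trans_eq ?_
  simp only [enorm_mul]

theorem comm_bound (σ : SchwartzMap ℝ ℂ) : ∃ C : ℝ≥0∞, C ≠ ∞ ∧ ∀ (n : ℕ) (p : ℝ≥0∞), 1 ≤ p →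
    ∀ w g : SchwartzMap ℝ ℂ, eLpNorm (SM (dil n σ) (SP w g) - SP w (SM (dil n σ) g) : SchwartzMap ℝ ℂ) p volume
      ≤ C * (2 ^ n)⁻¹ * eLpNorm (deriv w) ∞ volume * eLpNorm g p volume := by
  refine ⟨∫⁻ t, ‖t‖ₑ * ‖(𝓕⁻ σ) t‖ₑ, ?_, fun n p hp w g => ?_⟩
  · have := (SchwartzMap.integrable_pow_mul (μ := volume) (𝓕⁻ σ) 1).2
    refine (lt_of_eq_of_lt ?_ this).ne
    simp [enorm_mul]
  set L := eLpNorm (deriv w) ∞ volume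
  have hL : ∀ a b : ℝ, ‖w a - w b‖ₑ ≤ L * ‖a - b‖ₑ := by
    have hcont : Continuous (deriv w) := by rw [← SD_coe]; exact (SD w).continuous
    have hfin : L ≠ ∞ := by
      have := (SD w).eLpNorm_lt_top ∞ volume
      rw [SD_coe] at this
      exact this.ne
    have hae : ∀ᵐ x, ‖deriv w x‖ₑ ≤ L := by
      simpa [L] using ae_le_eLpNormEssSup (f := deriv w) (μ := volume)
    have hall : ∀ x, ‖deriv w x‖ₑ ≤ L := by
      have hd := Measure.dense_of_ae hae
      have hcl : IsClosed {x | ‖deriv w x‖ₑ ≤ L} := isClosed_le hcont.enorm continuous_const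
      intro x
      have := hd x
      rwa [hcl.closure_eq] at this
    have hlip : LipschitzWith L.toNNReal w := by
      apply lipschitzWith_of_nnnorm_deriv_le w.differentiable
      intro x
      have := hall x
      rw [← ENNReal.coe_toNNReal hfin, enorm_eq_nnnorm] at this
      exact_mod_cast this
    intro a b
    have := hlip a b
    rwa [ENNReal.coe_toNNReal hfin, edist_eq_enorm_sub, edist_eq_enorm_sub] at this
  have h := young_bound (fun t => L * (‖t‖ₑ * ‖(𝓕⁻ (dil n σ)) t‖ₑ))
    (by have := (𝓕⁻ (dil n σ)).continuous.measurable.enorm; fun_prop) p hp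
    (SM (dil n σ) (SP w g) - SP w (SM (dil n σ) g) : SchwartzMap ℝ ℂ) g g.continuous.measurable ?_
  · refine h.trans_eq ?_
    rw [lintegral_const_mul _ (by have := (𝓕⁻ (dil n σ)).continuous.measurable.enorm; fun_prop),
      lint_ker_dil']
    ring
  intro x
  have hint : ∀ u : SchwartzMap ℝ ℂ, Integrable (fun t => (𝓕⁻ (dil n σ)) t * u (x - t)) := by
    intro u
    refine ((𝓕⁻ (dil n σ)).integrable (μ := volume)).mul_bdd (c := SchwartzMap.seminorm ℝ 0 0 u) ?_ ?_
    · exact (u.continuous.comp (by fun_prop)).aestronglyMeasurable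
    · exact Filter.Eventually.of_forall fun t => SchwartzMap.norm_le_seminorm ℝ u _
  rw [sub_apply, SP_apply, SM_apply, SM_apply, ← integral_const_mul,
    ← integral_sub (hint _) ((hint _).const_mul _)]
  refine (enorm_integral_le_lintegral_enorm _).trans ?_
  refine lintegral_mono fun t => ?_
  rw [SP_apply]
  have : (𝓕⁻ (dil n σ)) t * (w (x - t) * g (x - t)) - w x * ((𝓕⁻ (dil n σ)) t * g (x - t))
    = (w (x - t) - w x) * (𝓕⁻ (dil n σ)) t * g (x - t) := by ring
  rw [this, enorm_mul, enorm_mul]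
  have h5 := hL (x - t) x
  have h6 : ‖x - t - x‖ₑ = ‖t‖ₑ := by
    rw [show x - t - x = -t by ring, enorm_neg]
  rw [h6] at h5
  calc _ ≤ (L * ‖t‖ₑ) * ‖(𝓕⁻ (dil n σ)) t‖ₑ * ‖g (x - t)‖ₑ := by gcongr
    _ = _ := by ring

structure LPdata (c d : SchwartzMap ℝ ℂ) : Prop where
  csupp : ∀ ξ : ℝ, c ξ ≠ 0 → |ξ| ≤ 4 / 3
  dsupp : ∀ ξ : ℝ, d ξ ≠ 0 → 3 / 4 ≤ |ξ| ∧ |ξ| ≤ 8 / 3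
  cone : ∀ ξ : ℝ, |ξ| < 3 / 4 → c ξ = 1
  tel : ∀ ξ : ℝ, c (ξ / 2) = c ξ + d ξ

theorem dil_apply' (n : ℕ) (σ : SchwartzMap ℝ ℂ) (ξ : ℝ) : dil n σ ξ = σ (ξ / 2 ^ n) := by
  rw [dil_apply, Real.rpow_neg (by norm_num), Real.rpow_natCast]
  congr 1
  field_simp

noncomputable def sym (c d : SchwartzMap ℝ ℂ) (j : ℕ) : SchwartzMap ℝ ℂ :=
  match j with
  | 0 => c
  | j + 1 => dil j d

theorem dil_zero (σ : SchwartzMap ℝ ℂ) : dil 0 σ = σ := by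
  ext ξ; simp [dil_apply']

theorem sym_succ {c d : SchwartzMap ℝ ℂ} (H : LPdata c d) (j : ℕ) (ξ : ℝ) :
    sym c d (j + 1) ξ = dil (j + 1) c ξ - dil j c ξ := by
  simp only [sym, dil_apply']
  have := H.tel (ξ / 2 ^ j)
  rw [div_div, ← pow_succ] at this
  rw [this]; ring

theorem sym_supp {c d : SchwartzMap ℝ ℂ} (H : LPdata c d) (j : ℕ) (ξ : ℝ) (h : sym c d j ξ ≠ 0) :
    |ξ| ≤ 4 / 3 * 2 ^ j := by
  cases j with
  | zero => simpa using H.csupp ξ h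
  | succ j =>
    simp only [sym, dil_apply'] at h
    have := (H.dsupp _ h).2
    rw [abs_div, abs_of_pos (show (0 : ℝ) < 2 ^ j by positivity), div_le_iff₀ (by positivity)] at this
    rw [pow_succ]; linarith

theorem sym_supp' {c d : SchwartzMap ℝ ℂ} (H : LPdata c d) (j : ℕ) (ξ : ℝ)
    (h : sym c d (j + 1) ξ ≠ 0) : 3 / 4 * 2 ^ j ≤ |ξ| := by
  simp only [sym, dil_apply'] at h
  have := (H.dsupp _ h).1
  rwa [abs_div, abs_of_pos (show (0 : ℝ) < 2 ^ j by positivity), le_div_iff₀ (by positivity)] at this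

theorem dilc_one {c d : SchwartzMap ℝ ℂ} (H : LPdata c d) (n : ℕ) (ξ : ℝ)
    (h : |ξ| < 3 / 4 * 2 ^ n) : dil n c ξ = 1 := by
  rw [dil_apply']
  apply H.cone
  rwa [abs_div, abs_of_pos (show (0 : ℝ) < 2 ^ n by positivity), div_lt_iff₀ (by positivity)]

theorem dilc_supp {c d : SchwartzMap ℝ ℂ} (H : LPdata c d) (n : ℕ) (ξ : ℝ)
    (h : dil n c ξ ≠ 0) : |ξ| ≤ 4 / 3 * 2 ^ n := by
  rw [dil_apply'] at h
  have := H.csupp _ h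
  rwa [abs_div, abs_of_pos (show (0 : ℝ) < 2 ^ n by positivity), div_le_iff₀ (by positivity)] at this

theorem lam_one {c d : SchwartzMap ℝ ℂ} (H : LPdata c d) (j : ℕ) (ξ η : ℝ)
    (h : sym c d j ξ ≠ 0) (hη : |η| ≤ 4 / 3 * 2 ^ (j - 3)) :
    ∑ k ∈ Finset.Icc (j - 2) (j + 2), sym c d k (ξ - η) = 1 := by
  have hs := sym_supp H j ξ h
  have h0 : ∀ ζ, sym c d 0 ζ = dil 0 c ζ := by intro ζ; rw [dil_zero]; rfl
  have t1 : |ξ - η| ≤ |ξ| + |η| := abs_sub _ _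
  have t2 : |ξ| - |η| ≤ |ξ - η| := abs_sub_abs_le_abs_sub _ _
  rcases lt_or_ge j 3 with hj | hj
  · have : ∑ k ∈ Finset.Icc (j - 2) (j + 2), sym c d k (ξ - η) = dil (j + 2) c (ξ - η) := by
      have hj2 : j - 2 = 0 := by omega
      have hI : Finset.Icc 0 (j + 2) = Finset.range (j + 3) := by ext k; simp; omega
      rw [hj2, hI, Finset.sum_range_succ', h0]
      simp only [sym_succ H]
      rw [Finset.sum_range_sub (fun k => dil k c (ξ - η))]
      ring
    rw [this]
    apply dilc_one H
    have hj3 : j - 3 = 0 := by omega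
    rw [hj3] at hη
    have : (1 : ℝ) ≤ 2 ^ j := one_le_pow₀ (by norm_num)
    rw [pow_add]
    norm_num at hη ⊢
    linarith
  · obtain ⟨i, rfl⟩ : ∃ i, j = i + 3 := ⟨j - 3, by omega⟩
    have e1 : i + 3 - 2 = i + 1 := by omega
    have e2 : i + 3 - 3 = i := by omega
    have h34 := sym_supp' H (i + 2) ξ h
    rw [e2] at hη
    have hX : (0 : ℝ) < 2 ^ i := by positivity
    simp only [pow_add] at h34 hs
    have : ∑ k ∈ Finset.Icc (i + 3 - 2) (i + 3 + 2), sym c d k (ξ - η)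
        = dil (i + 5) c (ξ - η) - dil i c (ξ - η) := by
      rw [e1]
      have : Finset.Icc (i + 1) (i + 3 + 2) = Finset.Ico (i + 1) (i + 6) := by
        ext k; simp; omega
      rw [this, Finset.sum_Ico_eq_sum_range]
      have : i + 6 - (i + 1) = 5 := by omega
      rw [this]
      have e : ∀ k, sym c d (i + 1 + k) (ξ - η) = dil (i + (k + 1)) c (ξ - η) - dil (i + k) c (ξ - η) := by
        intro k
        rw [show i + 1 + k = i + k + 1 by ring, sym_succ H]
        rfl
      simp only [e]
      rw [Finset.sum_range_sub (fun k => dil (i + k) c (ξ - η))]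
      simp
    rw [this, dilc_one H]
    · have : dil i c (ξ - η) = 0 := by
        by_contra hne
        have := dilc_supp H _ _ hne
        linarith
      rw [this, sub_zero]
    · simp only [pow_add]
      linarith

/-- Littlewood-Paley block -/
noncomputable def Blk (c d : SchwartzMap ℝ ℂ) (j : ℕ) (g : SchwartzMap ℝ ℂ) : SchwartzMap ℝ ℂ :=
  SM (sym c d j) g

theorem Blk_loc {c d : SchwartzMap ℝ ℂ} (H : LPdata c d) (j : ℕ) (v f : SchwartzMap ℝ ℂ) :
    let w := SM (dil (j - 3) c) v
    let G := ∑ k ∈ Finset.Icc (j - 2) (j + 2), Blk c d k f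
    Blk c d j (SP w (SD f)) - SP w (Blk c d j (SD f))
      = Blk c d j (SP w (SD G)) - SP w (Blk c d j (SD G)) := by
  intro w G
  have hG : ∀ ξ, (𝓕 G) ξ = (∑ k ∈ Finset.Icc (j - 2) (j + 2), sym c d k ξ) * (𝓕 f) ξ := by
    intro ξ
    simp only [G, four_sum, Blk, SM_apply_four, Finset.sum_mul]
  have h2 : Blk c d j (SD f) = Blk c d j (SD G) := by
    apply SM_ext
    intro ξ
    simp only [Blk, SM_apply_four, four_SD, hG]
    by_cases h : sym c d j ξ = 0
    · simp [h]
    · have := lam_one H j ξ 0 h (by simp)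
      rw [sub_zero] at this
      rw [this, one_mul]
  have h1 : Blk c d j (SP w (SD f)) = Blk c d j (SP w (SD G)) := by
    apply SM_ext
    intro ξ
    simp only [Blk, SM_apply_four]
    by_cases h : sym c d j ξ = 0
    · simp [h]
    congr 1
    rw [← sub_eq_zero, ← four_sub]
    have : SP w (SD f) - SP w (SD G) = SP w (SD f - SD G) := by
      ext x; simp only [sub_apply, SP_apply]; ring
    rw [this]
    apply four_SP_zero
    intro η hη
    rw [SM_apply_four] at hη
    have := lam_one H j ξ η h (dilc_supp H _ _ (left_ne_zero_of_mul hη))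
    rw [four_sub, four_SD, four_SD, hG, this]
    ring
  rw [h1, h2]

theorem Blk_bound (c d : SchwartzMap ℝ ℂ) : ∃ C : ℝ≥0∞, C ≠ ∞ ∧ ∀ (n : ℕ) (p : ℝ≥0∞), 1 ≤ p →
    ∀ g : SchwartzMap ℝ ℂ, eLpNorm (Blk c d n g) p volume ≤ C * eLpNorm g p volume := by
  obtain ⟨C1, h1, H1⟩ := SM_bound c
  obtain ⟨C2, h2, H2⟩ := SM_bound d
  refine ⟨C1 + C2, by finiteness, fun n p hp g => ?_⟩
  cases n with
  | zero =>
    have := H1 0 p hp g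
    rw [dil_zero] at this
    refine this.trans ?_
    gcongr; exact le_self_add
  | succ n =>
    refine (H2 n p hp g).trans ?_
    gcongr; exact le_add_self

theorem Blk_comm (c d : SchwartzMap ℝ ℂ) : ∃ C : ℝ≥0∞, C ≠ ∞ ∧ ∀ (n : ℕ) (p : ℝ≥0∞), 1 ≤ p →
    ∀ w g : SchwartzMap ℝ ℂ, eLpNorm (Blk c d n (SP w g) - SP w (Blk c d n g) : SchwartzMap ℝ ℂ) p volume
      ≤ C * (2 ^ n)⁻¹ * eLpNorm (deriv w) ∞ volume * eLpNorm g p volume := by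
  obtain ⟨C1, h1, H1⟩ := comm_bound c
  obtain ⟨C2, h2, H2⟩ := comm_bound d
  refine ⟨C1 + 2 * C2, by finiteness, fun n p hp w g => ?_⟩
  cases n with
  | zero =>
    have := H1 0 p hp w g
    rw [dil_zero] at this
    refine this.trans ?_
    gcongr; exact le_self_add
  | succ n =>
    refine (H2 n p hp w g).trans ?_
    have : C2 * (2 ^ n)⁻¹ = 2 * C2 * (2 ^ (n + 1))⁻¹ := by
      rw [pow_succ, ENNReal.mul_inv (by simp) (by simp)]
      calc _ = C2 * (2 ^ n)⁻¹ * 1 := by ring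
        _ = C2 * (2 ^ n)⁻¹ * (2 * 2⁻¹) := by rw [ENNReal.mul_inv_cancel (by simp) (by simp)]
        _ = _ := by ring
    rw [this]
    gcongr; exact le_add_self

theorem eLpNorm_smul_pow (a : ℂ) (g h : SchwartzMap ℝ ℂ) (p : ℝ≥0∞)
    (hg : ∀ ξ, (𝓕 g) ξ = a * (𝓕 h) ξ) : eLpNorm g p volume = ‖a‖ₑ * eLpNorm h p volume := by
  have : g = a • h := by
    apply SM_ext
    intro ξ
    rw [hg, FourierTransform.fourier_smul]
    simp
  rw [this, ← eLpNorm_const_smul]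
  rfl

theorem bern {c d : SchwartzMap ℝ ℂ} (H : LPdata c d) : ∃ C : ℝ≥0∞, C ≠ ∞ ∧
    ∀ (k : ℕ) (p : ℝ≥0∞), 1 ≤ p → ∀ g : SchwartzMap ℝ ℂ,
    eLpNorm (SD (Blk c d k g)) p volume ≤ C * 2 ^ k * eLpNorm (Blk c d k g) p volume := by
  set ρ : SchwartzMap ℝ ℂ := 𝓕 (SD (𝓕⁻ c)) with hρ
  have hρa : ∀ ξ : ℝ, ρ ξ = 2 * Real.pi * Complex.I * ξ * c ξ := by
    intro ξ
    rw [hρ, four_SD]; simp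
  obtain ⟨C, hC, HC⟩ := SM_bound ρ
  refine ⟨2 * C, by finiteness, fun k p hp g => ?_⟩
  rw [eLpNorm_smul_pow ((2 : ℂ) ^ (k + 1)) _ (SM (dil (k + 1) ρ) (Blk c d k g)), enorm_two_pow]
  · calc _ ≤ 2 ^ (k + 1) * (C * eLpNorm (Blk c d k g) p volume) := by
          gcongr; exact HC _ p hp _
      _ = _ := by ring
  · intro ξ
    rw [four_SD, SM_apply_four, Blk, SM_apply_four]
    by_cases h : sym c d k ξ = 0
    · simp [h]
    have h1 := sym_supp H k ξ h
    have h2 : dil (k + 1) c ξ = 1 := by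
      apply dilc_one H
      have : (0 : ℝ) < 2 ^ k := by positivity
      rw [pow_succ]; linarith
    rw [dil_apply'] at h2
    rw [dil_apply', hρa, h2]
    push_cast
    field_simp

theorem exists_tau {c d : SchwartzMap ℝ ℂ} (H : LPdata c d) : ∃ τ : SchwartzMap ℝ ℂ,
    ∀ ξ : ℝ, d ξ = τ ξ * (2 * Real.pi * Complex.I * ξ) * d ξ := by
  let F : ℝ → ℂ := fun ξ => (c (ξ / 4) - c (2 * ξ)) / (2 * Real.pi * Complex.I * ξ)
  have hF0 : ∀ ξ : ℝ, |ξ| < 3 / 8 → F ξ = 0 := by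
    intro ξ h
    simp only [F]
    rw [H.cone, H.cone]
    · simp
    · rw [abs_mul, abs_of_pos (by norm_num : (0:ℝ) < 2)]; linarith
    · rw [abs_div, abs_of_pos (by norm_num : (0:ℝ) < 4)]; linarith
  have hcs : HasCompactSupport F := by
    apply HasCompactSupport.intro (isCompact_closedBall (0 : ℝ) 6)
    intro x hx
    have hx : 6 < |x| := by simpa using hx
    have a1 : c (x / 4) = 0 := by
      by_contra h
      have := H.csupp _ h
      rw [abs_div, abs_of_pos (by norm_num : (0:ℝ) < 4)] at this
      linarith
    have a2 : c (2 * x) = 0 := by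
      by_contra h
      have := H.csupp _ h
      rw [abs_mul, abs_of_pos (by norm_num : (0:ℝ) < 2)] at this
      linarith
    simp [F, a1, a2]
  have hsm : ContDiff ℝ (⊤ : ℕ∞) F := by
    rw [contDiff_iff_contDiffAt]
    intro x
    by_cases hx : x = 0
    · subst hx
      have : F =ᶠ[nhds 0] fun _ => 0 := by
        filter_upwards [Metric.ball_mem_nhds (0 : ℝ) (by norm_num : (0:ℝ) < 3 / 8)] with y hy
        exact hF0 y (by simpa using hy)
      exact contDiffAt_const.congr_of_eventuallyEq this
    · have hcc : ContDiff ℝ (⊤ : ℕ∞) c := c.smooth _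
      have hofr : ContDiff ℝ (⊤ : ℕ∞) (fun ξ : ℝ => (ξ : ℂ)) := Complex.ofRealCLM.contDiff
      simp only [F, div_eq_mul_inv _ (2 * (Real.pi : ℂ) * Complex.I * _)]
      refine ContDiffAt.mul ?_ (ContDiffAt.inv ?_ ?_)
      · exact ((hcc.comp (contDiff_id.div_const 4)).sub
          (hcc.comp (contDiff_const.mul contDiff_id))).contDiffAt
      · exact (contDiff_const.mul hofr).contDiffAt
      · simp [hx, Real.pi_ne_zero]
  refine ⟨hcs.toSchwartzMap hsm, fun ξ => ?_⟩
  by_cases h : d ξ = 0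
  · simp [h]
  obtain ⟨h1, h2⟩ := H.dsupp ξ h
  have hx : ξ ≠ 0 := by
    rintro rfl; norm_num at h1
  have a1 : c (ξ / 4) = 1 := by
    apply H.cone
    rw [abs_div, abs_of_pos (by norm_num : (0:ℝ) < 4)]; linarith
  have a2 : c (2 * ξ) = 0 := by
    by_contra h
    have := H.csupp _ h
    rw [abs_mul, abs_of_pos (by norm_num : (0:ℝ) < 2)] at this
    linarith
  have : (hcs.toSchwartzMap hsm) ξ = F ξ := rfl
  rw [this]
  simp only [F, a1, a2]
  have hx' : (ξ : ℂ) ≠ 0 := by exact_mod_cast hx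
  have hp : (Real.pi : ℂ) ≠ 0 := by exact_mod_cast Real.pi_ne_zero
  have := Complex.I_ne_zero
  field_simp
  ring

theorem bern_inv {c d : SchwartzMap ℝ ℂ} (H : LPdata c d) : ∃ C : ℝ≥0∞, C ≠ ∞ ∧
    ∀ (k : ℕ) (p : ℝ≥0∞), 1 ≤ p → ∀ g : SchwartzMap ℝ ℂ,
    2 ^ (k + 1) * eLpNorm (Blk c d (k + 1) g) p volume
      ≤ C * eLpNorm (Blk c d (k + 1) (SD g)) p volume := by
  obtain ⟨τ, hτ⟩ := exists_tau H
  obtain ⟨C, hC, HC⟩ := SM_bound τ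
  refine ⟨2 * C, by finiteness, fun k p hp g => ?_⟩
  have h := eLpNorm_smul_pow ((2 : ℂ) ^ k) (SM (dil k τ) (Blk c d (k + 1) (SD g)))
    (Blk c d (k + 1) g) p ?_
  · rw [enorm_two_pow] at h
    rw [pow_succ, mul_right_comm, ← h]
    calc _ ≤ (C * eLpNorm (Blk c d (k + 1) (SD g)) p volume) * 2 := by
          gcongr; exact HC _ p hp _
      _ = _ := by ring
  · intro ξ
    simp only [SM_apply_four, Blk, four_SD, sym, dil_apply']
    have h1 := hτ (ξ / 2 ^ k)
    push_cast at h1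
    have h2 : (2 : ℂ) ^ k * ((ξ : ℂ) / 2 ^ k) = ξ := by field_simp
    linear_combination (-(2 : ℂ) ^ k * (𝓕 g) ξ) * h1 - (τ (ξ / 2 ^ k) * (2 * Real.pi * Complex.I) * d (ξ / 2 ^ k) * (𝓕 g) ξ) * h2

theorem tail_bound {c d : SchwartzMap ℝ ℂ} (H : LPdata c d) (m : ℕ) (p : ℝ≥0∞) (hp : 1 ≤ p)
    (v : SchwartzMap ℝ ℂ) :
    eLpNorm (v - SM (dil m c) v : SchwartzMap ℝ ℂ) p volume
      ≤ ∑' i : ℕ, eLpNorm (Blk c d (m + i + 1) v) p volume := by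
  have htel : ∀ N, ∑ i ∈ Finset.range N, Blk c d (m + i + 1) v
      = SM (dil (m + N) c) v - SM (dil m c) v := by
    intro N
    apply SM_ext
    intro ξ
    rw [four_sum, four_sub]
    simp only [Blk, SM_apply_four, sym_succ H]
    rw [← Finset.sum_mul, ← sub_mul]
    congr 1
    exact Finset.sum_range_sub (fun k => dil (m + k) c ξ) N
  have hpt : ∀ x, Filter.Tendsto (fun N => SM (dil (m + N) c) v x) Filter.atTop (nhds (v x)) := by
    intro x
    have hv : v x = (𝓕⁻ (𝓕 v)) x := by simp
    rw [hv]
    simp only [SM, SchwartzMap.fourierInv_coe, Real.fourierInv_eq']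
    obtain ⟨B, hB⟩ : ∃ B, ∀ ξ, ‖c ξ‖ ≤ B := ⟨_, fun ξ => SchwartzMap.norm_le_seminorm ℝ c ξ⟩
    refine tendsto_integral_of_dominated_convergence (fun ξ => B * ‖(𝓕 v) ξ‖) ?_ ?_ ?_ ?_
    · intro N
      have := (SP (dil (m + N) c) (𝓕 v)).continuous
      exact Continuous.aestronglyMeasurable (by fun_prop)
    · exact ((𝓕 v).integrable.norm.const_mul B)
    · intro N
      refine Filter.Eventually.of_forall fun ξ => ?_
      rw [norm_smul, Complex.norm_exp_ofReal_mul_I, one_mul, SP_apply, norm_mul, dil_apply']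
      gcongr
      exact hB _
    · refine Filter.Eventually.of_forall fun ξ => ?_
      apply Filter.Tendsto.const_smul
      apply tendsto_const_nhds.congr'
      have h2 : Filter.Tendsto (fun N : ℕ => (3 / 4 : ℝ) * 2 ^ N) Filter.atTop Filter.atTop :=
        (tendsto_pow_atTop_atTop_of_one_lt (by norm_num)).const_mul_atTop (by norm_num)
      filter_upwards [h2.eventually_gt_atTop |ξ|] with N hN
      rw [SP_apply, dilc_one H, one_mul]
      refine hN.trans_le ?_
      gcongr
      · norm_num
      · omega
  refine (Lp.eLpNorm_lim_le_liminf_eLpNorm (μ := volume) (p := p)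
    (f := fun N => ⇑(∑ i ∈ Finset.range N, Blk c d (m + i + 1) v))
    (fun N => (SchwartzMap.continuous _).aestronglyMeasurable) _ ?_).trans ?_
  · refine Filter.Eventually.of_forall fun x => ?_
    simp only [htel, sub_apply]
    exact (hpt x).sub_const _
  · refine Filter.liminf_le_of_le (by isBoundedDefault) ?_
    intro b hb
    obtain ⟨N, hN⟩ := hb.exists
    refine hN.trans ?_
    refine le_trans ?_ (ENNReal.sum_le_tsum (Finset.range N))
    rw [show ⇑(∑ i ∈ Finset.range N, Blk c d (m + i + 1) v)
      = ∑ i ∈ Finset.range N, ⇑(Blk c d (m + i + 1) v) by ext x; simp]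
    exact eLpNorm_sum_le (fun i _ => (SchwartzMap.continuous _).aestronglyMeasurable) hp

noncomputable def KK (j k : ℕ) : ℝ≥0∞ := if j ≤ k + 2 then 4 * (2 ^ (k + 2 - j))⁻¹ else 0

theorem KK_sum_aux (P : ℕ → Prop) [DecidablePred P] (φ : ℕ → ℕ)
    (hφ : ∀ a b, P a → P b → φ a = φ b → a = b) :
    ∑' k : ℕ, (if P k then 4 * ((2 : ℝ≥0∞) ^ (φ k))⁻¹ else 0) ≤ 8 := by
  have h1 : ∑' k : ℕ, (if P k then 4 * ((2 : ℝ≥0∞) ^ (φ k))⁻¹ else 0)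
      = ∑' k : {k | P k}, 4 * ((2 : ℝ≥0∞) ^ (φ k))⁻¹ := by
    rw [tsum_subtype {k | P k} (fun k => 4 * ((2 : ℝ≥0∞) ^ (φ k))⁻¹)]
    refine tsum_congr fun k => ?_
    simp [Set.indicator_apply]
  have h2 : ∑' k : {k | P k}, 4 * ((2 : ℝ≥0∞) ^ (φ k))⁻¹ ≤ ∑' i : ℕ, 4 * ((2 : ℝ≥0∞) ^ i)⁻¹ := by
    refine ENNReal.tsum_comp_le_tsum_of_injective (f := fun k : {k | P k} => φ k) ?_
      (fun i : ℕ => 4 * ((2 : ℝ≥0∞) ^ i)⁻¹)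
    intro a b hab
    exact Subtype.ext (hφ _ _ a.2 b.2 hab)
  rw [h1]
  refine h2.trans ?_
  rw [ENNReal.tsum_mul_left]
  have : ∑' i : ℕ, ((2 : ℝ≥0∞) ^ i)⁻¹ = 2 := by
    have e : ∀ i : ℕ, ((2 : ℝ≥0∞) ^ i)⁻¹ = 2⁻¹ ^ i := fun i => ENNReal.inv_pow
    rw [tsum_congr e]
    rw [ENNReal.tsum_geometric]
    simp
  rw [this]; norm_num

theorem KK_row (j : ℕ) : ∑' k, KK j k ≤ 8 :=
  KK_sum_aux (fun k => j ≤ k + 2) (fun k => k + 2 - j) (by intros; omega)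
theorem KK_col (k : ℕ) : ∑' j, KK j k ≤ 8 :=
  KK_sum_aux (fun j => j ≤ k + 2) (fun j => k + 2 - j) (by intros; omega)

theorem KK_one (j k : ℕ) (h : k ∈ Finset.Icc (j - 2) (j + 2)) : 1 ≤ 4 * KK j k := by
  rw [Finset.mem_Icc] at h
  have hle : j ≤ k + 2 := by omega
  rw [KK, if_pos hle, ← mul_assoc]
  have h4 : (2 : ℝ≥0∞) ^ (k + 2 - j) ≤ 2 ^ 4 := pow_le_pow_right₀ (by norm_num) (by omega)
  calc (1 : ℝ≥0∞) = (4 * 4) * (2 ^ 4)⁻¹ := by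
        rw [show (4 * 4 : ℝ≥0∞) = 2 ^ 4 by norm_num]
        exact (ENNReal.mul_inv_cancel (by simp) (by finiteness)).symm
    _ ≤ _ := by gcongr

theorem KK_two (j k : ℕ) (h : j ≤ k + 2) (x : ℝ≥0∞) : 2 ^ j * x = KK j k * (2 ^ k * x) := by
  rw [KK, if_pos h, ← mul_assoc]
  congr 1
  obtain ⟨i, hi⟩ := Nat.exists_eq_add_of_le h
  have : k + 2 - j = i := by omega
  rw [this]
  have h2 : (2 : ℝ≥0∞) ^ j * 2 ^ i = 4 * 2 ^ k := by
    rw [← pow_add, ← hi, pow_add]; ring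
  calc (2 : ℝ≥0∞) ^ j = 2 ^ j * 2 ^ i * (2 ^ i)⁻¹ := by
        rw [mul_assoc, ENNReal.mul_inv_cancel (by simp) (by finiteness), mul_one]
    _ = _ := by rw [h2]; ring

theorem KK_schur (r : ℝ≥0∞) (hr : 1 ≤ r) (b : ℕ → ℝ≥0∞) :
    eLpNorm (fun j => ∑' k, KK j k * b k) r Measure.count ≤ 8 * eLpNorm b r Measure.count := by
  have := schur_test (Measure.count : Measure ℕ) (Measure.count : Measure ℕ) KK
    (measurable_of_countable _) 8 (fun j => by rw [lintegral_count]; exact KK_row j)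
    (fun j => by rw [lintegral_count]; exact KK_col j) r hr b (measurable_of_countable _)
  simpa only [lintegral_count] using this

theorem holderS (p p₁ p₂ : ℝ≥0∞) (h : p₁⁻¹ + p₂⁻¹ = p⁻¹) (a b : SchwartzMap ℝ ℂ) :
    eLpNorm (SP a b) p volume ≤ eLpNorm a p₁ volume * eLpNorm b p₂ volume := by
  have : ENNReal.HolderTriple p₁ p₂ p := ⟨h⟩
  have := eLpNorm_le_eLpNorm_mul_eLpNorm_of_nnnorm (μ := volume) (p := p₁) (q := p₂) (r := p)
    a.continuous.aestronglyMeasurable b.continuous.aestronglyMeasurable (fun x y => x * y) 1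
    (by filter_upwards with x; simp)
  have e : ⇑(SP a b) = fun x => a x * b x := by ext x; exact SP_apply a b x
  rw [e]
  simpa using this

theorem SP_sub_left (a b g : SchwartzMap ℝ ℂ) : SP (a - b) g = SP a g - SP b g := by
  ext x; simp [SP_apply, sub_mul]

theorem SM_add (σ a b : SchwartzMap ℝ ℂ) : SM σ (a + b) = SM σ a + SM σ b := by
  apply SM_ext; intro ξ; simp only [SM_apply_four, four_add]; ring
theorem SM_sub (σ a b : SchwartzMap ℝ ℂ) : SM σ (a - b) = SM σ a - SM σ b := by
  apply SM_ext; intro ξ; simp only [SM_apply_four, four_sub]; ring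

theorem eLpS_add (a b : SchwartzMap ℝ ℂ) (p : ℝ≥0∞) (hp : 1 ≤ p) :
    eLpNorm (a + b : SchwartzMap ℝ ℂ) p volume ≤ eLpNorm a p volume + eLpNorm b p volume := by
  have : ⇑(a + b) = ⇑a + ⇑b := rfl
  rw [this]
  exact eLpNorm_add_le a.continuous.aestronglyMeasurable b.continuous.aestronglyMeasurable hp
theorem eLpS_sub (a b : SchwartzMap ℝ ℂ) (p : ℝ≥0∞) (hp : 1 ≤ p) :
    eLpNorm (a - b : SchwartzMap ℝ ℂ) p volume ≤ eLpNorm a p volume + eLpNorm b p volume := by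
  have : ⇑(a - b) = ⇑a - ⇑b := rfl
  rw [this]
  exact eLpNorm_sub_le a.continuous.aestronglyMeasurable b.continuous.aestronglyMeasurable hp
theorem eLpS_sum (s : Finset ℕ) (a : ℕ → SchwartzMap ℝ ℂ) (p : ℝ≥0∞) (hp : 1 ≤ p) :
    eLpNorm (∑ i ∈ s, a i : SchwartzMap ℝ ℂ) p volume ≤ ∑ i ∈ s, eLpNorm (a i) p volume := by
  induction s using Finset.induction_on with
  | empty => 
    rw [Finset.sum_empty, Finset.sum_empty]
    have : ⇑(0 : SchwartzMap ℝ ℂ) = 0 := rfl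
    rw [this, eLpNorm_zero]
  | insert i s hi ih =>
    rw [Finset.sum_insert hi, Finset.sum_insert hi]
    exact (eLpS_add _ _ p hp).trans (by gcongr)

theorem SD_sum (s : Finset ℕ) (a : ℕ → SchwartzMap ℝ ℂ) : SD (∑ i ∈ s, a i) = ∑ i ∈ s, SD (a i) := by
  simp [SD]

theorem tail_two {c d : SchwartzMap ℝ ℂ} (H : LPdata c d) : ∃ C : ℝ≥0∞, C ≠ ∞ ∧
    ∀ (j : ℕ) (p : ℝ≥0∞), 1 ≤ p → ∀ v : SchwartzMap ℝ ℂ,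
    2 ^ j * eLpNorm (v - SM (dil (j - 3) c) v : SchwartzMap ℝ ℂ) p volume
      ≤ C * ∑' k, KK j k * eLpNorm (Blk c d k (SD v)) p volume := by
  obtain ⟨C, hC, HC⟩ := bern_inv H
  refine ⟨C, hC, fun j p hp v => ?_⟩
  calc 2 ^ j * eLpNorm (v - SM (dil (j - 3) c) v : SchwartzMap ℝ ℂ) p volume
      ≤ 2 ^ j * ∑' i : ℕ, eLpNorm (Blk c d (j - 3 + i + 1) v) p volume := by
        gcongr; exact tail_bound H _ p hp v
    _ = ∑' i : ℕ, 2 ^ j * eLpNorm (Blk c d (j - 3 + i + 1) v) p volume := by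
        rw [ENNReal.tsum_mul_left]
    _ ≤ ∑' i : ℕ, C * (KK j (j - 3 + i + 1) * eLpNorm (Blk c d (j - 3 + i + 1) (SD v)) p volume) := by
        refine ENNReal.tsum_le_tsum fun i => ?_
        rw [KK_two j (j - 3 + i + 1) (by omega)]
        calc _ ≤ KK j (j - 3 + i + 1) * (C * eLpNorm (Blk c d (j - 3 + i + 1) (SD v)) p volume) := by
              exact mul_le_mul_right (HC _ p hp v) _
          _ = _ := by ring
    _ = C * ∑' i : ℕ, (KK j (j - 3 + i + 1) * eLpNorm (Blk c d (j - 3 + i + 1) (SD v)) p volume) := by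
        rw [ENNReal.tsum_mul_left]
    _ ≤ _ := by
        exact mul_le_mul_right (ENNReal.tsum_comp_le_tsum_of_injective (f := fun i => j - 3 + i + 1)
          (fun a b h => by simpa using h)
          (fun k => KK j k * eLpNorm (Blk c d k (SD v)) p volume)) _

theorem para_one {c d : SchwartzMap ℝ ℂ} (H : LPdata c d) : ∃ C : ℝ≥0∞, C ≠ ∞ ∧
    ∀ (j : ℕ) (p : ℝ≥0∞), 1 ≤ p → ∀ v f : SchwartzMap ℝ ℂ,
    2 ^ j * eLpNorm (Blk c d j (SP (SM (dil (j - 3) c) v) (SD f))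
        - SP (SM (dil (j - 3) c) v) (Blk c d j (SD f)) : SchwartzMap ℝ ℂ) p volume
      ≤ C * eLpNorm (deriv v) ∞ volume * ∑' k, KK j k * (2 ^ k * eLpNorm (Blk c d k f) p volume) := by
  obtain ⟨C1, h1, H1⟩ := Blk_comm c d
  obtain ⟨C2, h2, H2⟩ := SM_bound c
  obtain ⟨C3, h3, H3⟩ := bern H
  refine ⟨C1 * C2 * C3 * 4, by finiteness, fun j p hp v f => ?_⟩
  have hloc := Blk_loc H j v f
  simp only at hloc
  rw [hloc]
  set w := SM (dil (j - 3) c) v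
  set G := ∑ k ∈ Finset.Icc (j - 2) (j + 2), Blk c d k f
  have hw : eLpNorm (deriv w) ∞ volume ≤ C2 * eLpNorm (deriv v) ∞ volume := by
    rw [← SD_coe, ← SM_SD, ← SD_coe]
    exact H2 _ _ (by simp) _
  have hG : eLpNorm (SD G) p volume
      ≤ C3 * 4 * ∑' k, KK j k * (2 ^ k * eLpNorm (Blk c d k f) p volume) := by
    calc _ ≤ ∑ k ∈ Finset.Icc (j - 2) (j + 2), eLpNorm (SD (Blk c d k f)) p volume := by
          rw [SD_sum]; exact eLpS_sum _ _ p hp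
      _ ≤ ∑ k ∈ Finset.Icc (j - 2) (j + 2),
            C3 * 4 * (KK j k * (2 ^ k * eLpNorm (Blk c d k f) p volume)) := by
          refine Finset.sum_le_sum fun k hk => ?_
          calc _ ≤ 1 * (C3 * 2 ^ k * eLpNorm (Blk c d k f) p volume) := by
                rw [one_mul]; exact H3 k p hp f
            _ ≤ (4 * KK j k) * (C3 * 2 ^ k * eLpNorm (Blk c d k f) p volume) := by
                gcongr; exact KK_one j k hk
            _ = _ := by ring
      _ ≤ _ := by
          rw [← Finset.mul_sum]
          gcongr
          exact ENNReal.sum_le_tsum _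
  calc _ ≤ 2 ^ j * (C1 * (2 ^ j)⁻¹ * (C2 * eLpNorm (deriv v) ∞ volume) *
        (C3 * 4 * ∑' k, KK j k * (2 ^ k * eLpNorm (Blk c d k f) p volume))) := by
        gcongr
        refine (H1 j p hp w (SD G)).trans ?_
        gcongr
    _ = (2 ^ j * (2 ^ j)⁻¹) * (C1 * C2 * C3 * 4 * eLpNorm (deriv v) ∞ volume *
        ∑' k, KK j k * (2 ^ k * eLpNorm (Blk c d k f) p volume)) := by ring
    _ = _ := by rw [ENNReal.mul_inv_cancel (by simp) (by finiteness), one_mul]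

theorem main_pt {c d : SchwartzMap ℝ ℂ} (H : LPdata c d) : ∃ C : ℝ≥0∞, C ≠ ∞ ∧
    ∀ (j : ℕ) (p p₁ p₂ : ℝ≥0∞), 1 ≤ p → 1 ≤ p₁ → 1 ≤ p₂ → p₁⁻¹ + p₂⁻¹ = p⁻¹ →
    ∀ v f : SchwartzMap ℝ ℂ,
    2 ^ j * eLpNorm (Blk c d j (SP v (SD f)) - SP v (Blk c d j (SD f)) : SchwartzMap ℝ ℂ) p volume
      ≤ C * (eLpNorm (deriv v) ∞ volume * ∑' k, KK j k * (2 ^ k * eLpNorm (Blk c d k f) p volume)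
        + eLpNorm (deriv f) p₂ volume * ∑' k, KK j k * eLpNorm (Blk c d k (SD v)) p₁ volume) := by
  obtain ⟨C1, h1, H1⟩ := para_one H
  obtain ⟨C2, h2, H2⟩ := tail_two H
  obtain ⟨C3, h3, H3⟩ := Blk_bound c d
  refine ⟨C1 + 2 * C2 * C3, by finiteness, fun j p p₁ p₂ hp hp1 hp2 hh v f => ?_⟩
  set w := SM (dil (j - 3) c) v with hw
  have hE : Blk c d j (SP v (SD f)) - SP v (Blk c d j (SD f))
      = (Blk c d j (SP w (SD f)) - SP w (Blk c d j (SD f)))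
        + (Blk c d j (SP (v - w) (SD f)) - SP (v - w) (Blk c d j (SD f))) := by
    rw [SP_sub_left, SP_sub_left, Blk, Blk, Blk, Blk, SM_sub]; abel
  rw [hE]
  have hB : eLpNorm (Blk c d j (SP (v - w) (SD f)) - SP (v - w) (Blk c d j (SD f)) : SchwartzMap ℝ ℂ) p volume
      ≤ 2 * C3 * (eLpNorm (v - w : SchwartzMap ℝ ℂ) p₁ volume * eLpNorm (deriv f) p₂ volume) := by
    refine (eLpS_sub _ _ p hp).trans ?_
    have e1 := (H3 j p hp (SP (v - w) (SD f))).trans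
      (mul_le_mul_right (holderS p p₁ p₂ hh (v - w) (SD f)) C3)
    have e2 := (holderS p p₁ p₂ hh (v - w) (Blk c d j (SD f))).trans
      (mul_le_mul_right (H3 j p₂ hp2 (SD f)) _)
    refine (add_le_add e1 e2).trans (le_of_eq ?_)
    rw [SD_coe]; ring
  set a := ∑' k, KK j k * (2 ^ k * eLpNorm (Blk c d k f) p volume)
  set b := ∑' k, KK j k * eLpNorm (Blk c d k (SD v)) p₁ volume
  calc _ ≤ 2 ^ j * (eLpNorm (Blk c d j (SP w (SD f)) - SP w (Blk c d j (SD f)) : SchwartzMap ℝ ℂ) p volume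
          + 2 * C3 * (eLpNorm (v - w : SchwartzMap ℝ ℂ) p₁ volume * eLpNorm (deriv f) p₂ volume)) := by
        gcongr
        exact (eLpS_add _ _ p hp).trans (by gcongr)
    _ = 2 ^ j * eLpNorm (Blk c d j (SP w (SD f)) - SP w (Blk c d j (SD f)) : SchwartzMap ℝ ℂ) p volume
        + 2 * C3 * eLpNorm (deriv f) p₂ volume * (2 ^ j * eLpNorm (v - w : SchwartzMap ℝ ℂ) p₁ volume) := by
        ring
    _ ≤ C1 * eLpNorm (deriv v) ∞ volume * a + 2 * C3 * eLpNorm (deriv f) p₂ volume * (C2 * b) := by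
        exact add_le_add (H1 j p hp v f) (mul_le_mul_right (H2 j p₁ hp1 v) _)
    _ ≤ (C1 * eLpNorm (deriv v) ∞ volume * a + 2 * C3 * eLpNorm (deriv f) p₂ volume * (C2 * b))
        + (2 * C2 * C3 * eLpNorm (deriv v) ∞ volume * a + C1 * eLpNorm (deriv f) p₂ volume * b) :=
        le_self_add
    _ = _ := by ring

theorem main_seq {c d : SchwartzMap ℝ ℂ} (H : LPdata c d) : ∃ C : ℝ≥0∞, C ≠ ∞ ∧
    ∀ (p p₁ p₂ r : ℝ≥0∞), 1 ≤ r → 1 ≤ p → 1 ≤ p₁ → 1 ≤ p₂ → p₁⁻¹ + p₂⁻¹ = p⁻¹ →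
    ∀ v f : SchwartzMap ℝ ℂ,
    eLpNorm (fun j => 2 ^ j * eLpNorm (Blk c d j (SP v (SD f)) - SP v (Blk c d j (SD f)) : SchwartzMap ℝ ℂ) p volume) r Measure.count
      ≤ C * (eLpNorm (deriv v) ∞ volume * eLpNorm (fun k : ℕ => (2 ^ k * eLpNorm (Blk c d k f) p volume)) r Measure.count
        + eLpNorm (deriv f) p₂ volume * eLpNorm (fun k => eLpNorm (Blk c d k (SD v)) p₁ volume) r Measure.count) := by
  obtain ⟨C, hC, HC⟩ := main_pt H
  refine ⟨C * 8, by finiteness, fun p p₁ p₂ r hr hp hp1 hp2 hh v f => ?_⟩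
  set V := eLpNorm (deriv v) ∞ volume
  set F := eLpNorm (deriv f) p₂ volume
  have key : ∀ (x : ℝ≥0∞) (b : ℕ → ℝ≥0∞), eLpNorm (fun k => x * b k) r Measure.count
      ≤ x * eLpNorm b r Measure.count := by
    intro x b
    refine eLpNorm_le_mul_eLpNorm_of_ae_le_mul'' _ ?_ ?_
    · exact (measurable_of_countable _).aestronglyMeasurable
    · filter_upwards with k; simp
  refine (eLpNorm_mono_enorm (fun j => ?_) : _ ≤ eLpNorm (fun j => C * (V * ∑' k, KK j k * (2 ^ k * eLpNorm (Blk c d k f) p volume)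
        + F * ∑' k, KK j k * eLpNorm (Blk c d k (SD v)) p₁ volume)) r Measure.count).trans ?_
  · simp only [enorm_eq_self]
    exact HC j p p₁ p₂ hp hp1 hp2 hh v f
  refine (key _ _).trans ?_
  rw [mul_assoc]
  gcongr
  refine (eLpNorm_add_le (measurable_of_countable _).aestronglyMeasurable
    (measurable_of_countable _).aestronglyMeasurable hr).trans ?_
  rw [mul_add]
  gcongr
  · refine (key _ _).trans ?_
    refine (mul_le_mul_right (KK_schur r hr _) V).trans (le_of_eq ?_)
    ring
  · refine (key _ _).trans ?_
    refine (mul_le_mul_right (KK_schur r hr _) F).trans (le_of_eq ?_)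
    ring
theorem S_fin (g : SchwartzMap ℝ ℂ) (p : ℝ≥0∞) : eLpNorm g p volume ≠ ∞ :=
  (g.eLpNorm_lt_top p volume).ne

theorem seq_geo (r : ℝ≥0∞) (hr : 1 ≤ r) :
    eLpNorm (fun k : ℕ => ((2 : ℝ≥0∞) ^ k)⁻¹) r Measure.count ≠ ∞ := by
  have h := schur_test (Measure.count : Measure ℕ) (Measure.count : Measure ℕ) (fun j k => KK k j)
    (measurable_of_countable _) 8 (fun j => by rw [lintegral_count]; exact KK_col j)
    (fun j => by rw [lintegral_count]; exact KK_row j) r hr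
    (Set.indicator {0} (fun _ => (1 : ℝ≥0∞))) (measurable_of_countable _)
  have h2 : eLpNorm (Set.indicator {0} (fun _ : ℕ => (1 : ℝ≥0∞))) r Measure.count ≤ 1 := by
    refine (eLpNorm_indicator_const_le _ _).trans ?_
    simp
  refine ne_top_of_le_ne_top (b := 8 * 1) (by finiteness) ?_
  refine (eLpNorm_mono_enorm fun j => ?_).trans (h.trans (by gcongr))
  simp only [enorm_eq_self, lintegral_count]
  refine le_trans (le_of_eq ?_) (ENNReal.le_tsum 0)
  have h4 : (4 : ℝ≥0∞) * 4⁻¹ = 1 := ENNReal.mul_inv_cancel (by simp) (by simp)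
  simp only [KK, Nat.zero_le, if_true, Nat.sub_zero, Set.indicator_apply, Set.mem_singleton_iff,
    mul_one]
  rw [pow_add, ENNReal.mul_inv (by simp) (by simp), mul_comm, mul_assoc]
  norm_num
  rw [mul_comm (4⁻¹ : ℝ≥0∞), h4, mul_one]

theorem seq_fin {c d : SchwartzMap ℝ ℂ} (H : LPdata c d) (p r : ℝ≥0∞) (hp : 1 ≤ p) (hr : 1 ≤ r)
    (g : SchwartzMap ℝ ℂ) :
    eLpNorm (fun k : ℕ => 2 ^ k * eLpNorm (Blk c d k g) p volume) r Measure.count ≠ ∞ := by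
  obtain ⟨C, hC, HC⟩ := bern_inv H
  obtain ⟨B, hB, HB⟩ := Blk_bound c d
  have f1 : eLpNorm g p volume ≠ ∞ := S_fin g p
  have f2 : eLpNorm (SD (SD g)) p volume ≠ ∞ := S_fin _ p
  set D := B * eLpNorm g p volume + C * (C * (B * eLpNorm (SD (SD g)) p volume)) with hD
  have hDf : D ≠ ∞ := by finiteness
  have hk : ∀ k : ℕ, 2 ^ k * eLpNorm (Blk c d k g) p volume ≤ D * (2 ^ k)⁻¹ := by
    intro k
    cases k with
    | zero =>
      simp only [pow_zero, one_mul, inv_one, mul_one]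
      exact (HB 0 p hp g).trans le_self_add
    | succ k =>
      rw [← div_eq_mul_inv, ENNReal.le_div_iff_mul_le (by simp) (by simp), mul_comm]
      calc _ ≤ 2 ^ (k + 1) * (C * eLpNorm (Blk c d (k + 1) (SD g)) p volume) :=
            mul_le_mul_right (HC k p hp g) _
        _ = C * (2 ^ (k + 1) * eLpNorm (Blk c d (k + 1) (SD g)) p volume) := by ring
        _ ≤ C * (C * eLpNorm (Blk c d (k + 1) (SD (SD g))) p volume) :=
            mul_le_mul_right (HC k p hp (SD g)) _
        _ ≤ C * (C * (B * eLpNorm (SD (SD g)) p volume)) := by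
            gcongr; exact HB _ p hp _
        _ ≤ D := le_add_self
  refine ne_top_of_le_ne_top (ENNReal.mul_ne_top hDf (seq_geo r hr)) ?_
  refine eLpNorm_le_mul_eLpNorm_of_ae_le_mul'' _ ?_ ?_
  · exact (measurable_of_countable _).aestronglyMeasurable
  · filter_upwards with k
    simpa using hk k

theorem seq_fin0 {c d : SchwartzMap ℝ ℂ} (H : LPdata c d) (p r : ℝ≥0∞) (hp : 1 ≤ p) (hr : 1 ≤ r)
    (g : SchwartzMap ℝ ℂ) :
    eLpNorm (fun k : ℕ => eLpNorm (Blk c d k g) p volume) r Measure.count ≠ ∞ := by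
  refine ne_top_of_le_ne_top (seq_fin H p r hp hr g) (eLpNorm_mono_enorm fun k => ?_)
  simp only [enorm_eq_self]
  exact le_mul_of_one_le_left (by simp) (one_le_pow₀ (by norm_num))

theorem LPdata_mk (c d : SchwartzMap ℝ ℂ)
    (hχsupp : ∀ ξ : ℝ, c ξ ≠ 0 → |ξ| ≤ 4 / 3)
    (hφsupp : ∀ ξ : ℝ, d ξ ≠ 0 → 3 / 4 ≤ |ξ| ∧ |ξ| ≤ 8 / 3)
    (hpart : ∀ ξ : ℝ, c ξ + ∑' j : ℕ, d ((2 : ℝ) ^ (-(j : ℝ)) * ξ) = 1) : LPdata c d := by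
  have habs : ∀ (j : ℕ) (ξ : ℝ), |(2 : ℝ) ^ (-(j : ℝ)) * ξ| = |ξ| / 2 ^ j := by
    intro j ξ
    rw [abs_mul, Real.rpow_neg (by norm_num), Real.rpow_natCast, abs_of_pos (by positivity)]
    field_simp
  refine ⟨hχsupp, hφsupp, fun ξ hξ => ?_, fun ξ => ?_⟩
  · have h := hpart ξ
    have h0 : ∀ j : ℕ, d ((2 : ℝ) ^ (-(j : ℝ)) * ξ) = 0 := by
      intro j
      by_contra hne
      have := (hφsupp _ hne).1
      rw [habs] at this
      have h1 : |ξ| / 2 ^ j ≤ |ξ| := div_le_self (abs_nonneg _) (one_le_pow₀ (by norm_num))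
      linarith
    rwa [tsum_congr h0, tsum_zero, add_zero] at h
  · have hs : Summable (fun j : ℕ => d ((2 : ℝ) ^ (-(j : ℝ)) * ξ)) := by
      obtain ⟨N, hN⟩ := pow_unbounded_of_one_lt (4 / 3 * |ξ|) (by norm_num : (1 : ℝ) < 2)
      refine summable_of_ne_finset_zero (s := Finset.range N) (fun j hj => ?_)
      by_contra hne
      have := (hφsupp _ hne).1
      rw [habs, le_div_iff₀ (by positivity)] at this
      have h2 : (2 : ℝ) ^ N ≤ 2 ^ j := pow_le_pow_right₀ (by norm_num) (by simpa using hj)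
      linarith
    have h1 := hpart ξ
    have h2 := hpart (ξ / 2)
    rw [hs.tsum_eq_zero_add] at h1
    have e : ∀ j : ℕ, d ((2 : ℝ) ^ (-(j : ℝ)) * (ξ / 2)) = d ((2 : ℝ) ^ (-((j + 1 : ℕ) : ℝ)) * ξ) := by
      intro j
      congr 1
      rw [Real.rpow_neg (by norm_num), Real.rpow_neg (by norm_num), Real.rpow_natCast,
        Real.rpow_natCast, pow_succ]
      field_simp
    rw [tsum_congr e] at h2
    simp only [Nat.cast_zero, neg_zero, Real.rpow_zero, one_mul] at h1
    linear_combination h2 - h1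

theorem LPblock_eq (c d g : SchwartzMap ℝ ℂ) (j : ℕ) :
    LPblock (⇑c) (⇑d) j (⇑g) = ⇑(Blk c d j g) := by
  cases j with
  | zero =>
    simp only [LPblock, if_true, Blk, sym, SM]
    rw [SchwartzMap.fourierInv_coe]
    congr 1
  | succ j =>
    simp only [LPblock, Nat.succ_ne_zero, if_false, Blk, sym, SM]
    rw [SchwartzMap.fourierInv_coe]
    congr 1
    ext ξ
    rw [SP_apply, SchwartzMap.fourier_coe, dil_apply]
    congr 4
    push_cast
    ring

theorem enorm_seq (j : ℕ) (X : ℝ≥0∞) (hX : X ≠ ∞) :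
    ‖(2 : ℝ) ^ ((j : ℝ) - 1) * X.toReal‖ₑ = 2⁻¹ * (2 ^ j * X) := by
  have h5 : ‖(2 : ℝ)⁻¹‖ₑ = 2⁻¹ := by
    rw [enorm_inv (by norm_num), ← ofReal_norm]; simp
  rw [Real.rpow_sub (by norm_num), Real.rpow_natCast, Real.rpow_one, div_eq_mul_inv, enorm_mul,
    enorm_mul, enorm_pow, h5]
  have h2 : ‖(2 : ℝ)‖ₑ = 2 := by rw [← ofReal_norm]; simp
  have h3 : ‖X.toReal‖ₑ = X := by
    rw [Real.enorm_eq_ofReal ENNReal.toReal_nonneg, ENNReal.ofReal_toReal hX]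
  rw [h2, h3]; ring

theorem final_S {c d : SchwartzMap ℝ ℂ} (H : LPdata c d)
    (p p₁ p₂ r : ℝ≥0∞) (hr : 1 ≤ r) (hp : 1 ≤ p) (hpp₁ : p ≤ p₁)
    (hp₂ : 1 / p₂ = 1 / p - 1 / p₁) :
    ∃ C > (0 : ℝ), ∀ v f : SchwartzMap ℝ ℂ,
      (eLpNorm
          (fun j : ℕ => (2 : ℝ) ^ ((j : ℝ) - 1) *
            (eLpNorm
              (fun x : ℝ =>
                LPblock c d j (fun y => v y * deriv (⇑f) y) x
                  - v x * deriv (LPblock c d j ⇑f) x)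
              p volume).toReal)
          r Measure.count).toReal
        ≤ C * ((eLpNorm (deriv ⇑v) ∞ volume).toReal * besovNorm c d 1 p r ⇑f
            + (eLpNorm (deriv ⇑f) p₂ volume).toReal *
                besovNorm c d 0 p₁ r (deriv ⇑v)) := by
  simp only [one_div] at hp₂
  have hh : p₁⁻¹ + p₂⁻¹ = p⁻¹ := by
    rw [hp₂, add_comm]; exact tsub_add_cancel_of_le (ENNReal.inv_le_inv.2 hpp₁)
  have hp1 : 1 ≤ p₁ := hp.trans hpp₁
  have hp2 : 1 ≤ p₂ := by
    rw [← ENNReal.inv_le_one, hp₂]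
    exact tsub_le_self.trans (ENNReal.inv_le_one.2 hp)
  obtain ⟨C, hC, HC⟩ := main_seq H
  refine ⟨(C * 2).toReal + 1, by positivity, fun v f => ?_⟩
  have key := HC p p₁ p₂ r hr hp hp1 hp2 hh v f
  have hV : eLpNorm (deriv ⇑v) ∞ volume ≠ ∞ := by
    rw [← SD_coe]; exact S_fin _ _
  have hF : eLpNorm (deriv ⇑f) p₂ volume ≠ ∞ := by
    rw [← SD_coe]; exact S_fin _ _
  set V := eLpNorm (deriv ⇑v) ∞ volume
  set F := eLpNorm (deriv ⇑f) p₂ volume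
  have fA := seq_fin H p r hp hr f
  have fB := seq_fin0 H p₁ r hp1 hr (SD v)
  -- left side
  have hL : eLpNorm (fun j : ℕ => (2 : ℝ) ^ ((j : ℝ) - 1) *
            (eLpNorm
              (fun x : ℝ =>
                LPblock c d j (fun y => v y * deriv (⇑f) y) x
                  - v x * deriv (LPblock c d j ⇑f) x)
              p volume).toReal) r Measure.count
      ≤ eLpNorm (fun j => 2 ^ j * eLpNorm (Blk c d j (SP v (SD f)) - SP v (Blk c d j (SD f)) : SchwartzMap ℝ ℂ) p volume) r Measure.count := by
    refine eLpNorm_mono_enorm fun j => ?_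
    have e : (fun x : ℝ => LPblock c d j (fun y => v y * deriv (⇑f) y) x
                  - v x * deriv (LPblock c d j ⇑f) x)
        = ⇑(Blk c d j (SP v (SD f)) - SP v (Blk c d j (SD f)) : SchwartzMap ℝ ℂ) := by
      have e1 : (fun y => v y * deriv (⇑f) y) = ⇑(SP v (SD f)) := by
        ext y; rw [SP_apply, SD_coe]
      ext x
      rw [e1, LPblock_eq, LPblock_eq, ← SD_coe]
      simp only [Blk, ← SM_SD, sub_apply, SP_apply]
    rw [e, enorm_seq _ _ (S_fin _ _), enorm_eq_self]
    refine mul_le_of_le_one_left (by simp) ?_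
    simp
  -- right side
  set A' := eLpNorm (fun j : ℕ => (2 : ℝ) ^ (((j : ℝ) - 1) * 1) *
        (eLpNorm (LPblock c d j ⇑f) p volume).toReal) r Measure.count with hA'
  set B' := eLpNorm (fun j : ℕ => (2 : ℝ) ^ (((j : ℝ) - 1) * 0) *
        (eLpNorm (LPblock c d j (deriv ⇑v)) p₁ volume).toReal) r Measure.count with hB'
  have eA : ∀ j : ℕ, ‖(2 : ℝ) ^ (((j : ℝ) - 1) * 1) *
        (eLpNorm (LPblock c d j ⇑f) p volume).toReal‖ₑ
        = 2⁻¹ * (2 ^ j * eLpNorm (Blk c d j f) p volume) := by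
    intro j
    rw [mul_one, LPblock_eq, enorm_seq _ _ (S_fin _ _)]
  have eB : ∀ j : ℕ, ‖(2 : ℝ) ^ (((j : ℝ) - 1) * 0) *
        (eLpNorm (LPblock c d j (deriv ⇑v)) p₁ volume).toReal‖ₑ
        = eLpNorm (Blk c d j (SD v)) p₁ volume := by
    intro j
    rw [mul_zero, Real.rpow_zero, one_mul, ← SD_coe, LPblock_eq,
      Real.enorm_eq_ofReal ENNReal.toReal_nonneg,
      ENNReal.ofReal_toReal (S_fin _ _)]
  have hAle : A' ≤ eLpNorm (fun k : ℕ => (2 ^ k * eLpNorm (Blk c d k f) p volume)) r Measure.count := by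
    refine eLpNorm_mono_enorm fun j => ?_
    rw [eA, enorm_eq_self]
    refine mul_le_of_le_one_left (by simp) ?_
    simp
  have hAge : eLpNorm (fun k : ℕ => (2 ^ k * eLpNorm (Blk c d k f) p volume)) r Measure.count
      ≤ 2 * A' := by
    refine eLpNorm_le_mul_eLpNorm_of_ae_le_mul'' _ ?_ ?_
    · exact (measurable_of_countable _).aestronglyMeasurable
    · filter_upwards with k
      rw [eA, ← mul_assoc, ENNReal.mul_inv_cancel (by simp) (by simp), one_mul, enorm_eq_self]
  have hBeq : eLpNorm (fun k => eLpNorm (Blk c d k (SD v)) p₁ volume) r Measure.count = B' := by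
    refine eLpNorm_congr_enorm_ae ?_
    filter_upwards with k
    rw [eB, enorm_eq_self]
  have hA'f : A' ≠ ∞ := ne_top_of_le_ne_top fA hAle
  have hB'f : B' ≠ ∞ := hBeq ▸ fB
  rw [hBeq] at key
  have fin : eLpNorm (fun j : ℕ => (2 : ℝ) ^ ((j : ℝ) - 1) *
            (eLpNorm
              (fun x : ℝ =>
                LPblock c d j (fun y => v y * deriv (⇑f) y) x
                  - v x * deriv (LPblock c d j ⇑f) x)
              p volume).toReal) r Measure.count ≤ C * 2 * (V * A' + F * B') := by
    refine hL.trans (key.trans ?_)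
    calc _ ≤ C * (V * (2 * A') + 2 * (F * B')) := by
          refine mul_le_mul_right (add_le_add (mul_le_mul_right hAge _) ?_) _
          exact le_mul_of_one_le_left (by simp) (by norm_num)
      _ = _ := by ring
  have fin2 := ENNReal.toReal_mono (by finiteness) fin
  have eR : (C * 2 * (V * A' + F * B')).toReal
      = (C * 2).toReal * (V.toReal * A'.toReal + F.toReal * B'.toReal) := by
    rw [ENNReal.toReal_mul, ENNReal.toReal_add (by finiteness) (by finiteness),
      ENNReal.toReal_mul (a := V), ENNReal.toReal_mul (a := F)]
  rw [eR] at fin2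
  refine fin2.trans ?_
  change _ ≤ ((C * 2).toReal + 1) * (V.toReal * A'.toReal + F.toReal * B'.toReal)
  refine mul_le_mul_of_nonneg_right (by linarith) (by positivity)

/-- commutator estimate (Lemma 2.100 of Bahouri–Chemin–Danchin).
For `1 ≤ r ≤ ∞`, `1 ≤ p ≤ p₁ ≤ ∞`, `1/p₂ = 1/p - 1/p₁`,
`‖(2ʲ ‖[Δⱼ, v∂ₓ]f‖_{L^p})ⱼ‖_{ℓ^r} ≤ C (‖∂ₓv‖_{L^∞} ‖f‖_{B¹_{p,r}} + ‖∂ₓf‖_{L^{p₂}} ‖∂ₓv‖_{B⁰_{p₁,r}})`. -/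
theorem stmt15 (χ φsym : ℝ → ℂ)
    (hχsm : ContDiff ℝ (⊤ : ℕ∞) χ) (hφsm : ContDiff ℝ (⊤ : ℕ∞) φsym)
    (hχsupp : ∀ ξ : ℝ, χ ξ ≠ 0 → |ξ| ≤ 4 / 3)
    (hφsupp : ∀ ξ : ℝ, φsym ξ ≠ 0 → 3 / 4 ≤ |ξ| ∧ |ξ| ≤ 8 / 3)
    (hpart : ∀ ξ : ℝ, χ ξ + ∑' j : ℕ, φsym ((2 : ℝ) ^ (-(j : ℝ)) * ξ) = 1)
    (p p₁ p₂ r : ℝ≥0∞) (hr : 1 ≤ r) (hp : 1 ≤ p) (hpp₁ : p ≤ p₁)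
    (hp₂ : 1 / p₂ = 1 / p - 1 / p₁) :
    ∃ C > (0 : ℝ), ∀ v f : SchwartzMap ℝ ℂ,
      (eLpNorm
          (fun j : ℕ => (2 : ℝ) ^ ((j : ℝ) - 1) *
            (eLpNorm
              (fun x : ℝ =>
                LPblock χ φsym j (fun y => v y * deriv (⇑f) y) x
                  - v x * deriv (LPblock χ φsym j ⇑f) x)
              p volume).toReal)
          r Measure.count).toReal
        ≤ C * ((eLpNorm (deriv ⇑v) ∞ volume).toReal * besovNorm χ φsym 1 p r ⇑f
            + (eLpNorm (deriv ⇑f) p₂ volume).toReal *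
                besovNorm χ φsym 0 p₁ r (deriv ⇑v)) := by
  have hcc : HasCompactSupport χ := by
    refine HasCompactSupport.intro (isCompact_Icc (a := (-3 : ℝ)) (b := 3)) fun x hx => ?_
    by_contra hne
    have := abs_le.1 (hχsupp x hne)
    exact hx ⟨by linarith [this.1], by linarith [this.2]⟩
  have hdc : HasCompactSupport φsym := by
    refine HasCompactSupport.intro (isCompact_Icc (a := (-3 : ℝ)) (b := 3)) fun x hx => ?_
    by_contra hne
    have := abs_le.1 (hφsupp x hne).2
    exact hx ⟨by linarith [this.1], by linarith [this.2]⟩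
  exact final_S (c := hcc.toSchwartzMap hχsm) (d := hdc.toSchwartzMap hφsm)
    (LPdata_mk _ _ hχsupp hφsupp hpart) p p₁ p₂ r hr hp hpp₁ hp₂
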